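/- arXiv:2605.02825 — 5 statements merged into one kernel-verified Lean document; each statement's English description precedes it below -/
import Mathlib

section
/- Let d, m ≥ 1, let H be a real m×d matrix, let R be a symmetric positive definite m×m matrix and P a symmetric positive definite d×d matrix, and let x ∈ ℝ^m, m̂ ∈ ℝ^d. Set S = H·P·Hᵀ + R, K = P·Hᵀ·S⁻¹, m' = m̂ + K·(x − H·m̂) and P' = (I − K·H)·P. Then P' is symmetric positive definite, and there exists a constant c > 0 such that for every θ ∈ ℝ^d: exp(−(1/2)·(x − H·θ)ᵀ·R⁻¹·(x − H·θ)) · exp(−(1/2)·(θ − m̂)ᵀ·P⁻¹·(θ − m̂)) = c · exp(−(1/2)·(θ − m')ᵀ·(P')⁻¹·(θ − m')). -/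
open Matrix

/-- Kalman filter measurement update: the product of the Gaussian likelihood
(observation `x`, observation matrix `H`, noise covariance `R`) and the Gaussian
prior (mean `m̂`, covariance `P`) is, up to a positive constant, the Gaussian with
mean `m' = m̂ + K(x − Hm̂)` and covariance `P' = (I − KH)P`, where
`S = HPHᵀ + R` and `K = PHᵀS⁻¹`; moreover `P'` is symmetric positive definite. -/
theorem kalman_measurement_update
    (d m : ℕ) (hd : 1 ≤ d) (hm : 1 ≤ m)
    (H : Matrix (Fin m) (Fin d) ℝ) (R : Matrix (Fin m) (Fin m) ℝ)
    (P : Matrix (Fin d) (Fin d) ℝ) (hR : R.PosDef) (hP : P.PosDef)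
    (x : Fin m → ℝ) (mhat : Fin d → ℝ) :
    ((1 - P * Hᵀ * (H * P * Hᵀ + R)⁻¹ * H) * P).PosDef ∧
    ∃ c : ℝ, 0 < c ∧ ∀ θ : Fin d → ℝ,
      Real.exp (-(1 / 2) * ((x - H.mulVec θ) ⬝ᵥ R⁻¹.mulVec (x - H.mulVec θ))) *
        Real.exp (-(1 / 2) * ((θ - mhat) ⬝ᵥ P⁻¹.mulVec (θ - mhat))) =
      c * Real.exp (-(1 / 2) *
        ((θ - (mhat + (P * Hᵀ * (H * P * Hᵀ + R)⁻¹).mulVec (x - H.mulVec mhat))) ⬝ᵥ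
          (((1 - P * Hᵀ * (H * P * Hᵀ + R)⁻¹ * H) * P)⁻¹).mulVec
            (θ - (mhat + (P * Hᵀ * (H * P * Hᵀ + R)⁻¹).mulVec (x - H.mulVec mhat))))) := by
  have hRu : IsUnit R.det := (Matrix.isUnit_iff_isUnit_det _).1 hR.isUnit
  have hPu : IsUnit P.det := (Matrix.isUnit_iff_isUnit_det _).1 hP.isUnit
  have hS : (H * P * Hᵀ + R).PosDef := by
    have h := hP.posSemidef.mul_mul_conjTranspose_same H
    rw [Matrix.conjTranspose_eq_transpose_of_trivial] at h
    exact Matrix.PosDef.posSemidef_add h hR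
  have hSu : IsUnit (H * P * Hᵀ + R).det := (Matrix.isUnit_iff_isUnit_det _).1 hS.isUnit
  have hA : (P⁻¹ + Hᵀ * R⁻¹ * H).PosDef := by
    have h := hR.inv.posSemidef.conjTranspose_mul_mul_same H
    rw [Matrix.conjTranspose_eq_transpose_of_trivial] at h
    exact hP.inv.add_posSemidef h
  have hST := Matrix.mul_nonsing_inv _ hSu
  generalize (H * P * Hᵀ + R)⁻¹ = T at *
  have hRsym : R⁻¹ᵀ = R⁻¹ := by
    have h := hR.inv.isHermitian.eq
    rwa [Matrix.conjTranspose_eq_transpose_of_trivial] at h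
  have hAsym : (P⁻¹ + Hᵀ * R⁻¹ * H)ᵀ = P⁻¹ + Hᵀ * R⁻¹ * H := by
    have h := hA.isHermitian.eq
    rwa [Matrix.conjTranspose_eq_transpose_of_trivial] at h
  have hAK : (P⁻¹ + Hᵀ * R⁻¹ * H) * (P * Hᵀ * T) = Hᵀ * R⁻¹ := by
    have e1 : H * P * Hᵀ * T = 1 - R * T := by
      rw [← hST, Matrix.add_mul]; abel
    calc (P⁻¹ + Hᵀ * R⁻¹ * H) * (P * Hᵀ * T)
        = (P⁻¹ * P) * Hᵀ * T + Hᵀ * R⁻¹ * (H * P * Hᵀ * T) := by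
          simp only [Matrix.add_mul, Matrix.mul_assoc]
      _ = Hᵀ * T + (Hᵀ * R⁻¹ - Hᵀ * (R⁻¹ * R) * T) := by
          rw [e1, Matrix.nonsing_inv_mul _ hPu, Matrix.mul_sub]
          simp only [Matrix.mul_assoc, Matrix.one_mul, Matrix.mul_one]
      _ = Hᵀ * R⁻¹ := by
          rw [Matrix.nonsing_inv_mul _ hRu, Matrix.mul_one]; abel
  have hAP : (P⁻¹ + Hᵀ * R⁻¹ * H) * ((1 - P * Hᵀ * T * H) * P) = 1 := by
    calc (P⁻¹ + Hᵀ * R⁻¹ * H) * ((1 - P * Hᵀ * T * H) * P)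
        = (P⁻¹ + Hᵀ * R⁻¹ * H) * P
            - ((P⁻¹ + Hᵀ * R⁻¹ * H) * (P * Hᵀ * T)) * H * P := by
          rw [Matrix.sub_mul, Matrix.mul_sub, Matrix.one_mul]
          simp only [Matrix.mul_assoc]
      _ = 1 := by
          rw [hAK, Matrix.add_mul, Matrix.nonsing_inv_mul _ hPu]; abel
  have hinv : (P⁻¹ + Hᵀ * R⁻¹ * H)⁻¹ = (1 - P * Hᵀ * T * H) * P :=
    Matrix.inv_eq_right_inv hAP
  have hinv' : ((1 - P * Hᵀ * T * H) * P)⁻¹ = P⁻¹ + Hᵀ * R⁻¹ * H :=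
    Matrix.inv_eq_left_inv hAP
  refine ⟨hinv ▸ hA.inv, ?_⟩
  rw [hinv']
  generalize hAdef : P⁻¹ + Hᵀ * R⁻¹ * H = A at *
  generalize P * Hᵀ * T = K at *
  obtain ⟨y, hy⟩ : ∃ y, y = x - H *ᵥ mhat := ⟨_, rfl⟩
  rw [← hy]
  refine ⟨Real.exp (-(1 / 2) * (y ⬝ᵥ R⁻¹ *ᵥ y - (K *ᵥ y) ⬝ᵥ A *ᵥ (K *ᵥ y))),
    Real.exp_pos _, fun θ => ?_⟩
  obtain ⟨u, hu⟩ : ∃ u, u = θ - mhat := ⟨_, rfl⟩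
  have h1 : x - H *ᵥ θ = y - H *ᵥ u := by
    rw [hy, hu, Matrix.mulVec_sub]; abel
  have h2 : θ - (mhat + K *ᵥ y) = u - K *ᵥ y := by
    rw [hu]; abel
  rw [h1, h2, ← hu, ← Real.exp_add, ← Real.exp_add]
  congr 1
  have sR : ∀ a b : Fin m → ℝ, a ⬝ᵥ R⁻¹ *ᵥ b = b ⬝ᵥ R⁻¹ *ᵥ a := fun a b => by
    rw [Matrix.dotProduct_mulVec, ← Matrix.mulVec_transpose, hRsym, dotProduct_comm]
  have sA : ∀ a b : Fin d → ℝ, a ⬝ᵥ A *ᵥ b = b ⬝ᵥ A *ᵥ a := fun a b => by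
    rw [Matrix.dotProduct_mulVec, ← Matrix.mulVec_transpose, hAsym, dotProduct_comm]
  have tH : ∀ v : Fin m → ℝ, u ⬝ᵥ Hᵀ *ᵥ v = (H *ᵥ u) ⬝ᵥ v := fun v => by
    rw [Matrix.dotProduct_mulVec, Matrix.vecMul_transpose]
  have q1 : u ⬝ᵥ A *ᵥ (K *ᵥ y) = (H *ᵥ u) ⬝ᵥ R⁻¹ *ᵥ y := by
    rw [Matrix.mulVec_mulVec, hAK, ← Matrix.mulVec_mulVec, tH]
  have q2 : u ⬝ᵥ A *ᵥ u = u ⬝ᵥ P⁻¹ *ᵥ u + (H *ᵥ u) ⬝ᵥ R⁻¹ *ᵥ (H *ᵥ u) := by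
    rw [← hAdef, Matrix.add_mulVec, dotProduct_add, ← Matrix.mulVec_mulVec,
      ← Matrix.mulVec_mulVec, tH]
  have q3 := sR y (H *ᵥ u)
  have q4 := sA (K *ᵥ y) u
  simp only [Matrix.mulVec_sub, dotProduct_sub, sub_dotProduct] at *
  linarith
end

section
/- Let d ≥ 1, let B be an invertible real d×d matrix, set Σ = B·Bᵀ, let μ ∈ ℝ^d and c > 0, and let E = {θ ∈ ℝ^d : (θ − μ)ᵀ·Σ⁻¹·(θ − μ) ≤ c}. Let γ be the law of a standard Gaussian vector on ℝ^d (the product of d copies of N(0,1)) and let λ be the uniform distribution on the interval (0,1]. Then the pushforward of the product measure γ ⊗ λ under the map (x, u) ↦ μ + B·(√c · u^{1/d} · x/‖x‖), where ‖x‖ is the Euclidean norm of x, equals the uniform probability distribution on E, i.e. the normalised restriction of d-dimensional Lebesgue measure to E. -/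
open Matrix MeasureTheory ProbabilityTheory

open scoped ENNReal

abbrev USphere (d : ℕ) := Metric.sphere (0 : EuclideanSpace ℝ (Fin d)) 1

lemma polar_lintegral (d : ℕ) (hd : 1 ≤ d) (f : (Fin d → ℝ) → ℝ≥0∞) (hf : Measurable f) :
    ∫⁻ x, f x = ∫⁻ s : USphere d, (∫⁻ r in Set.Ioi (0:ℝ),
      ENNReal.ofReal (r ^ (d-1)) * f (r • WithLp.ofLp s.1)) ∂(Measure.toSphere volume) := by
  have : Nontrivial (EuclideanSpace ℝ (Fin d)) := by
    have : Nonempty (Fin d) := ⟨⟨0, hd⟩⟩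
    infer_instance
  have hof : Measurable (fun x : EuclideanSpace ℝ (Fin d) => WithLp.ofLp x) :=
    (PiLp.volume_preserving_ofLp (Fin d)).measurable
  rw [← (PiLp.volume_preserving_ofLp (Fin d)).lintegral_comp hf]
  have h0 : ∫⁻ x : EuclideanSpace ℝ (Fin d), f (WithLp.ofLp x) =
      ∫⁻ x : ({0}ᶜ : Set (EuclideanSpace ℝ (Fin d))), f (WithLp.ofLp x.1)
        ∂(Measure.comap Subtype.val volume) := by
    rw [lintegral_subtype_comap (measurableSet_singleton _).compl
      (fun x : EuclideanSpace ℝ (Fin d) => f (WithLp.ofLp x)), restrict_compl_singleton]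
  rw [h0]
  have h := (Measure.measurePreserving_homeomorphUnitSphereProd
    (volume : Measure (EuclideanSpace ℝ (Fin d)))).symm
      (homeomorphUnitSphereProd (EuclideanSpace ℝ (Fin d))).toMeasurableEquiv
  have hg : Measurable (fun x : ({0}ᶜ : Set (EuclideanSpace ℝ (Fin d))) => f (WithLp.ofLp x.1)) :=
    hf.comp (hof.comp measurable_subtype_coe)
  rw [← h.lintegral_comp hg]
  refine (lintegral_prod _ (hg.comp h.measurable).aemeasurable).trans ?_
  refine lintegral_congr fun s => ?_
  rw [Measure.volumeIoiPow, lintegral_withDensity_eq_lintegral_mul]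
  · rw [← lintegral_subtype_comap measurableSet_Ioi]
    refine lintegral_congr fun r => ?_
    simp [Homeomorph.toMeasurableEquiv]
  · fun_prop
  · exact (hg.comp h.measurable).comp measurable_prodMk_left

lemma lintegral_pi_prod (n : ℕ) (f : Fin n → ℝ → ℝ≥0∞) (hf : ∀ i, Measurable (f i)) :
    ∫⁻ x : Fin n → ℝ, ∏ i, f i (x i) = ∏ i, ∫⁻ t, f i t := by
  induction n with
  | zero => simp [lintegral_unique, volume_pi]
  | succ n ih =>
    have h := (volume_preserving_piFinSuccAbove (fun _ : Fin (n+1) => ℝ) 0).symm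
    rw [← h.lintegral_comp (by fun_prop), Fin.prod_univ_succ, ← ih (fun i => f i.succ) (fun i => hf _)]
    rw [← lintegral_prod_mul (hf 0).aemeasurable (Finset.measurable_prod _ fun i _ => (hf i.succ).comp (measurable_pi_apply i)).aemeasurable]
    refine lintegral_congr fun p => ?_
    simp [Fin.prod_univ_succ, MeasurableEquiv.piFinSuccAbove]

lemma pi_gauss (d : ℕ) : (Measure.pi fun _ : Fin d => gaussianReal 0 1) =
    (volume : Measure (Fin d → ℝ)).withDensity (fun x => ∏ i, gaussianPDF 0 1 (x i)) := by
  refine Measure.pi_eq fun s hs => ?_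
  have hm := measurable_gaussianPDF 0 1
  rw [withDensity_apply _ (MeasurableSet.univ_pi hs), ← lintegral_indicator (MeasurableSet.univ_pi hs)]
  have : ∀ i, gaussianReal 0 1 (s i) = ∫⁻ t, (s i).indicator (gaussianPDF 0 1) t := fun i => by
    rw [gaussianReal_apply _ one_ne_zero, lintegral_indicator (hs i)]
  simp_rw [this]
  rw [← lintegral_pi_prod _ _ (fun i => hm.indicator (hs i))]
  refine lintegral_congr fun x => ?_
  classical
  by_cases hx : x ∈ Set.univ.pi s
  · rw [Set.indicator_of_mem hx]
    exact Finset.prod_congr rfl fun i _ => (Set.indicator_of_mem (hx i trivial) _).symm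
  · rw [Set.indicator_of_notMem hx]
    simp only [Set.mem_pi, Set.mem_univ, true_implies, not_forall] at hx
    obtain ⟨i, hi⟩ := hx
    exact (Finset.prod_eq_zero (Finset.mem_univ i) (Set.indicator_of_notMem hi _)).symm

lemma prod_pdf (d : ℕ) (x : Fin d → ℝ) : ∏ i, gaussianPDF 0 1 (x i) =
    ENNReal.ofReal ((√(2 * Real.pi))⁻¹ ^ d * Real.exp (-(∑ i, x i ^ 2) / 2)) := by
  simp only [gaussianPDF]
  rw [← ENNReal.ofReal_prod_of_nonneg fun i _ => gaussianPDFReal_nonneg _ _ _]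
  simp only [gaussianPDFReal, Finset.prod_mul_distrib, ← Real.exp_sum]
  simp [Finset.sum_div, Finset.sum_neg_distrib, neg_div]

lemma subst_u (d : ℕ) (hd : 1 ≤ d) (a : ℝ) (ha : 0 < a) (h : ℝ → ℝ≥0∞) :
    ∫⁻ u in Set.Ioc (0:ℝ) 1, h (a * u ^ ((1:ℝ)/d)) =
    ENNReal.ofReal (d / a ^ d) * ∫⁻ r in Set.Ioc (0:ℝ) a, ENNReal.ofReal (r ^ (d-1)) * h r := by
  have hd0 : d ≠ 0 := by omega
  have himg : (fun r : ℝ => (r / a) ^ d) '' Set.Ioc 0 a = Set.Ioc 0 1 := by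
    ext u
    constructor
    · rintro ⟨r, ⟨h0, h1⟩, rfl⟩
      have : r / a ≤ 1 := (div_le_one ha).2 h1
      exact ⟨by positivity, pow_le_one₀ (by positivity) this⟩
    · rintro ⟨h0, h1⟩
      refine ⟨a * u ^ ((d:ℝ)⁻¹), ⟨by positivity, ?_⟩, ?_⟩
      · have : u ^ ((d:ℝ)⁻¹) ≤ 1 := Real.rpow_le_one h0.le h1 (by positivity)
        nlinarith
      · simp only
        rw [mul_div_cancel_left₀ _ ha.ne', Real.rpow_inv_natCast_pow h0.le hd0]
  rw [← himg, lintegral_image_eq_lintegral_abs_deriv_mul (f' := fun r => d * (r / a) ^ (d-1) * (1 / a))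
    measurableSet_Ioc]
  · rw [← lintegral_const_mul' _ _ ENNReal.ofReal_ne_top]
    refine setLIntegral_congr_fun measurableSet_Ioc fun r hr => ?_
    have hr0 := hr.1
    simp only [one_div]
    rw [Real.pow_rpow_inv_natCast (by positivity) hd0, mul_div_cancel₀ _ ha.ne', ← mul_assoc,
      ← ENNReal.ofReal_mul (by positivity), abs_of_nonneg (by positivity)]
    congr 2
    obtain ⟨k, rfl⟩ : ∃ k, d = k + 1 := ⟨d - 1, by omega⟩
    simp only [Nat.add_sub_cancel, div_pow]
    rw [pow_succ a k]
    field_simp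
  · intro r _
    exact (((hasDerivAt_id r).div_const a).pow d).hasDerivWithinAt
  · intro r hr t ht hrt
    have := (pow_left_inj₀ (div_nonneg hr.1.le ha.le) (div_nonneg ht.1.le ha.le) hd0).1 hrt
    exact (div_left_inj' ha.ne').1 this

lemma main_aux (d : ℕ) (hd : 1 ≤ d) (a : ℝ) (ha : 0 < a) : ∃ K : ℝ≥0∞,
    Measure.map
      (fun p : (Fin d → ℝ) × ℝ =>
          ((a * p.2 ^ ((1 : ℝ) / d) * (Real.sqrt (∑ i, p.1 i ^ 2))⁻¹) • p.1))
      ((Measure.pi fun _ : Fin d => gaussianReal 0 1).prod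
        (volume.restrict (Set.Ioc (0 : ℝ) 1)))
      = K • volume.restrict {x : Fin d → ℝ | ∑ i, x i ^ 2 ≤ a ^ 2} := by
  set G : ℝ → ℝ≥0∞ := fun r =>
    ENNReal.ofReal ((√(2 * Real.pi))⁻¹ ^ d * Real.exp (-(r ^ 2) / 2)) with hG
  have hGm : Measurable G := by fun_prop
  have hS : MeasurableSet {x : Fin d → ℝ | ∑ i, x i ^ 2 ≤ a ^ 2} :=
    measurableSet_le (by fun_prop) (by fun_prop)
  refine ⟨(∫⁻ r in Set.Ioi (0:ℝ), ENNReal.ofReal (r ^ (d-1)) * G r) * ENNReal.ofReal (d / a ^ d), ?_⟩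
  have hT : Measurable (fun p : (Fin d → ℝ) × ℝ =>
          ((a * p.2 ^ ((1 : ℝ) / d) * (Real.sqrt (∑ i, p.1 i ^ 2))⁻¹) • p.1)) := by fun_prop
  refine Measure.ext_of_lintegral _ fun f hf => ?_
  have hfT := hf.comp hT
  have hinner : Measurable (fun x : Fin d → ℝ => ∫⁻ u in Set.Ioc (0:ℝ) 1,
      f ((a * u ^ ((1 : ℝ) / d) * (Real.sqrt (∑ i, x i ^ 2))⁻¹) • x)) := hfT.lintegral_prod_right'
  have hdens : Measurable (fun x : Fin d → ℝ => ∏ i, gaussianPDF 0 1 (x i)) := by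
    have := measurable_gaussianPDF 0 1
    fun_prop
  have hsph : ∀ s : USphere d, ∑ i, (WithLp.ofLp s.1) i ^ 2 = 1 := fun s => by
    have := s.2
    rw [mem_sphere_zero_iff_norm, EuclideanSpace.norm_eq, Real.sqrt_eq_one] at this
    simpa using this
  have hsr : ∀ (s : USphere d) (r : ℝ), ∑ i, (r • WithLp.ofLp s.1) i ^ 2 = r ^ 2 := fun s r => by
    simp [mul_pow, ← Finset.mul_sum, hsph]
  rw [lintegral_map hf hT]
  refine (lintegral_prod _ hfT.aemeasurable).trans ?_
  simp only [Function.comp_apply]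
  rw [pi_gauss,
    lintegral_withDensity_eq_lintegral_mul _ hdens hinner, polar_lintegral d hd _ (hdens.mul hinner),
    lintegral_smul_measure, ← lintegral_indicator hS, polar_lintegral d hd _ (hf.indicator hS),
    smul_eq_mul, ← lintegral_const_mul _ ?_]
  · refine lintegral_congr fun s => ?_
    have h1 : ∀ r ∈ Set.Ioi (0:ℝ), ENNReal.ofReal (r ^ (d-1)) * ((fun x : Fin d → ℝ => ∏ i, gaussianPDF 0 1 (x i)) * fun x : Fin d → ℝ => ∫⁻ u in Set.Ioc (0:ℝ) 1,
      f ((a * u ^ ((1 : ℝ) / d) * (Real.sqrt (∑ i, x i ^ 2))⁻¹) • x)) (r • WithLp.ofLp s.1) =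
      (ENNReal.ofReal (r ^ (d-1)) * G r) * ∫⁻ u in Set.Ioc (0:ℝ) 1, f ((a * u ^ ((1:ℝ)/d)) • WithLp.ofLp s.1) := by
      intro r hr
      have hr : 0 < r := hr
      simp only [Pi.mul_apply]
      rw [prod_pdf, hsr, Real.sqrt_sq hr.le, mul_assoc]
      simp only [smul_smul, mul_assoc, inv_mul_cancel₀ hr.ne', mul_one]
      rfl
    rw [setLIntegral_congr_fun measurableSet_Ioi h1, lintegral_mul_const _ (by fun_prop),
      subst_u d hd a ha (fun t => f (t • WithLp.ofLp s.1)), mul_assoc]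
    congr 2
    rw [← lintegral_indicator measurableSet_Ioc, ← lintegral_indicator measurableSet_Ioi]
    refine lintegral_congr fun r => ?_
    by_cases hr : 0 < r
    · by_cases hra : r ≤ a
      · have : r • WithLp.ofLp s.1 ∈ {x : Fin d → ℝ | ∑ i, x i ^ 2 ≤ a ^ 2} := by
          rw [Set.mem_ofPred_eq, hsr]; gcongr
        rw [Set.indicator_of_mem (Set.mem_Ioc.2 ⟨hr, hra⟩), Set.indicator_of_mem (Set.mem_Ioi.2 hr),
          Set.indicator_of_mem this]
      · have : r • WithLp.ofLp s.1 ∉ {x : Fin d → ℝ | ∑ i, x i ^ 2 ≤ a ^ 2} := by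
          rw [Set.mem_ofPred_eq, hsr, not_le]
          have := not_le.1 hra
          gcongr
        rw [Set.indicator_of_notMem (fun h => hra h.2), Set.indicator_of_mem (Set.mem_Ioi.2 hr),
          Set.indicator_of_notMem this, mul_zero]
    · rw [Set.indicator_of_notMem (fun h => hr h.1), Set.indicator_of_notMem (fun h => hr (Set.mem_Ioi.1 h))]
  · have : Measurable (fun p : USphere d × ℝ => ENNReal.ofReal (p.2 ^ (d-1)) *
        ({x : Fin d → ℝ | ∑ i, x i ^ 2 ≤ a ^ 2}.indicator f) (p.2 • WithLp.ofLp p.1.1)) := by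
      refine Measurable.mul (by fun_prop) ((hf.indicator hS).comp ?_)
      exact measurable_snd.smul ((PiLp.volume_preserving_ofLp (Fin d)).measurable.comp
        (measurable_subtype_coe.comp measurable_fst))
    exact this.lintegral_prod_right'

theorem uniform_ellipsoid_sampling
    (d : ℕ) (hd : 1 ≤ d) (B : Matrix (Fin d) (Fin d) ℝ) (hB : IsUnit B.det)
    (μ : Fin d → ℝ) (c : ℝ) (hc : 0 < c) :
    Measure.map
      (fun p : (Fin d → ℝ) × ℝ =>
        μ + B.mulVec
          ((Real.sqrt c * p.2 ^ ((1 : ℝ) / d) * (Real.sqrt (∑ i, p.1 i ^ 2))⁻¹) • p.1))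
      ((Measure.pi fun _ : Fin d => gaussianReal 0 1).prod
        (volume.restrict (Set.Ioc (0 : ℝ) 1)))
      = (volume {θ : Fin d → ℝ | (θ - μ) ⬝ᵥ ((B * Bᵀ)⁻¹).mulVec (θ - μ) ≤ c})⁻¹ •
          volume.restrict {θ : Fin d → ℝ | (θ - μ) ⬝ᵥ ((B * Bᵀ)⁻¹).mulVec (θ - μ) ≤ c} := by
  set E := {θ : Fin d → ℝ | (θ - μ) ⬝ᵥ ((B * Bᵀ)⁻¹).mulVec (θ - μ) ≤ c} with hE
  have hEm : MeasurableSet E := by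
    refine measurableSet_le (Continuous.measurable ?_) measurable_const
    fun_prop
  obtain ⟨K, hK⟩ := main_aux d hd (√c) (Real.sqrt_pos.2 hc)
  have hT : Measurable (fun p : (Fin d → ℝ) × ℝ =>
      ((√c * p.2 ^ ((1 : ℝ) / d) * (Real.sqrt (∑ i, p.1 i ^ 2))⁻¹) • p.1)) := by fun_prop
  have hBm : Measurable (fun x : Fin d → ℝ => B.mulVec x) :=
    Continuous.measurable (by fun_prop)
  have hA : Measurable (fun x : Fin d → ℝ => μ + B.mulVec x) := hBm.const_add μ
  have hpre : {x : Fin d → ℝ | ∑ i, x i ^ 2 ≤ √c ^ 2} = (fun x => μ + B.mulVec x) ⁻¹' E := by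
    ext x
    have : (B.mulVec x) ⬝ᵥ ((B * Bᵀ)⁻¹).mulVec (B.mulVec x) = ∑ i, x i ^ 2 := by
      rw [Matrix.mul_inv_rev, Matrix.mulVec_mulVec, Matrix.mul_assoc, Matrix.nonsing_inv_mul _ hB,
        Matrix.mul_one, dotProduct_comm, Matrix.dotProduct_mulVec, ← Matrix.mulVec_transpose,
        Matrix.mulVec_mulVec, Matrix.mul_nonsing_inv _ (by rwa [Matrix.det_transpose]),
        Matrix.one_mulVec]
      simp [dotProduct, sq]
    simp only [hE, Set.mem_ofPred_eq, Set.mem_preimage, add_sub_cancel_left, this, Real.sq_sqrt hc.le]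
  have hvol : Measure.map (fun x : Fin d → ℝ => μ + B.mulVec x) volume =
      ENNReal.ofReal |B.det⁻¹| • (volume : Measure (Fin d → ℝ)) := by
    have h1 := Real.map_matrix_volume_pi_eq_smul_volume_pi hB.ne_zero
    have h2 : Measure.map (fun x : Fin d → ℝ => μ + B.mulVec x) volume =
      Measure.map (fun x => μ + x) (Measure.map (Matrix.toLin' B) volume) :=
        (Measure.map_map (measurable_const_add μ) hBm).symm
    rw [h2, h1, Measure.map_smul, map_add_left_eq_self]
  have key : Measure.map
      (fun p : (Fin d → ℝ) × ℝ =>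
        μ + B.mulVec
          ((Real.sqrt c * p.2 ^ ((1 : ℝ) / d) * (Real.sqrt (∑ i, p.1 i ^ 2))⁻¹) • p.1))
      ((Measure.pi fun _ : Fin d => gaussianReal 0 1).prod
        (volume.restrict (Set.Ioc (0 : ℝ) 1)))
      = (K * ENNReal.ofReal |B.det⁻¹|) • volume.restrict E := by
    refine (Measure.map_map hA hT).symm.trans ?_
    rw [hK, Measure.map_smul, hpre, ← Measure.restrict_map hA hEm, hvol, Measure.restrict_smul,
      smul_smul]
  have hprob : IsProbabilityMeasure (volume.restrict (Set.Ioc (0 : ℝ) 1)) := ⟨by simp⟩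
  have hone := congrArg (fun m => m Set.univ) key
  simp only [Measure.smul_apply, Measure.restrict_apply_univ, smul_eq_mul] at hone
  have hAT : Measurable (fun p : (Fin d → ℝ) × ℝ => μ + B.mulVec
      ((√c * p.2 ^ ((1 : ℝ) / d) * (Real.sqrt (∑ i, p.1 i ^ 2))⁻¹) • p.1)) := hA.comp hT
  rw [Measure.map_apply hAT MeasurableSet.univ, Set.preimage_univ, measure_univ] at hone
  rw [key, ENNReal.eq_inv_of_mul_eq_one_left hone.symm]
end

section
/- Let y : ℕ → ℝ be a sequence with y(j) ∈ {0, 1} for every j ≥ 1, and for k ≥ 1 define a_k = ∑_{j=1}^k 1/j² + ∑_{j=1}^k y(j) and b_k = k + ∑_{j=1}^k 1/j² − ∑_{j=1}^k y(j). Suppose there exists J such that y(j) = 1 for all j ≥ J. Then for every δ ∈ (0,1), the ratio (∫_{(1−δ,1)} x^{a_k−1}·(1−x)^{b_k−1} dx) / (∫_{(0,1)} x^{a_k−1}·(1−x)^{b_k−1} dx) tends to 1 as k → ∞. -/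
open MeasureTheory Filter

/-- Abstract form: first exponent tends to infinity, second one stays in `[0, C]`. -/
theorem beta_aux (p q : ℕ → ℝ) (C : ℝ) (hp : Tendsto p atTop atTop)
    (hq : ∀ᶠ k in atTop, 0 ≤ q k ∧ q k ≤ C) (δ : ℝ) (hδ0 : 0 < δ) (hδ1 : δ < 1) :
    Tendsto (fun k : ℕ =>
      (∫ x in Set.Ioo (1 - δ) 1, x ^ (p k) * (1 - x) ^ (q k)) /
      (∫ x in Set.Ioo (0 : ℝ) 1, x ^ (p k) * (1 - x) ^ (q k))) atTop (nhds 1) := by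
  obtain ⟨r, hr⟩ : ∃ r, r = 1 - δ := ⟨_, rfl⟩
  rw [← hr]
  have hr0 : 0 < r := by linarith
  have hr1 : r < 1 := by linarith
  obtain ⟨s, hs⟩ : ∃ s, s = (1 + r) / 2 := ⟨_, rfl⟩
  obtain ⟨t, ht⟩ : ∃ t, t = (1 + s) / 2 := ⟨_, rfl⟩
  have hs0 : 0 < s := by linarith
  have hrs : r < s := by linarith
  have hst : s < t := by linarith
  have ht1 : t < 1 := by linarith
  obtain ⟨K, hK⟩ : ∃ K, K = (1 - t) ^ C * (t - s) := ⟨_, rfl⟩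
  have hK0 : 0 < K := by
    rw [hK]; exact mul_pos (Real.rpow_pos_of_pos (by linarith) _) (by linarith)
  have hlim : Tendsto (fun k => 1 - (r / s) ^ (p k) / K) atTop (nhds 1) := by
    have h1 : Tendsto (fun k => (r / s) ^ (p k)) atTop (nhds 0) :=
      (tendsto_rpow_atTop_of_base_lt_one (r / s)
        (by have := div_pos hr0 hs0; linarith) ((div_lt_one hs0).2 hrs)).comp hp
    simpa using (h1.div_const K).const_sub 1
  have key : ∀ᶠ k in atTop,
      1 - (r / s) ^ (p k) / K ≤ (∫ x in Set.Ioo r 1, x ^ (p k) * (1 - x) ^ (q k)) /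
      (∫ x in Set.Ioo (0 : ℝ) 1, x ^ (p k) * (1 - x) ^ (q k)) ∧
      (∫ x in Set.Ioo r 1, x ^ (p k) * (1 - x) ^ (q k)) /
      (∫ x in Set.Ioo (0 : ℝ) 1, x ^ (p k) * (1 - x) ^ (q k)) ≤ 1 := by
    filter_upwards [hq, hp.eventually_ge_atTop 0] with k hqk hpk
    obtain ⟨hq0, hqC⟩ := hqk
    have hcont : Continuous (fun x : ℝ => x ^ (p k) * (1 - x) ^ (q k)) :=
      (Real.continuous_rpow_const hpk).mul
        ((Real.continuous_rpow_const hq0).comp (continuous_const.sub continuous_id))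
    have hint : ∀ u v : ℝ, IntegrableOn (fun x : ℝ => x ^ (p k) * (1 - x) ^ (q k))
        (Set.Ioo u v) := fun u v =>
      (hcont.continuousOn.integrableOn_compact isCompact_Icc).mono_set Set.Ioo_subset_Icc_self
    have hint2 : ∀ u v : ℝ, IntegrableOn (fun x : ℝ => x ^ (p k) * (1 - x) ^ (q k))
        (Set.Ioc u v) := fun u v =>
      (hcont.continuousOn.integrableOn_compact isCompact_Icc).mono_set Set.Ioc_subset_Icc_self
    have hsplit : (∫ x in Set.Ioo (0 : ℝ) 1, x ^ (p k) * (1 - x) ^ (q k)) =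
        (∫ x in Set.Ioc (0 : ℝ) r, x ^ (p k) * (1 - x) ^ (q k)) +
        ∫ x in Set.Ioo r 1, x ^ (p k) * (1 - x) ^ (q k) := by
      rw [← setIntegral_union _ measurableSet_Ioo (hint2 _ _) (hint _ _),
        Set.Ioc_union_Ioo_eq_Ioo hr0.le hr1]
      rw [Set.disjoint_left]
      intro x hx hx'
      exact absurd hx.2 (not_le.2 hx'.1)
    have hlow0 : 0 ≤ ∫ x in Set.Ioc (0 : ℝ) r, x ^ (p k) * (1 - x) ^ (q k) :=
      setIntegral_nonneg measurableSet_Ioc fun x hx =>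
        mul_nonneg (Real.rpow_nonneg hx.1.le _) (Real.rpow_nonneg (by linarith [hx.2]) _)
    have hlow : (∫ x in Set.Ioc (0 : ℝ) r, x ^ (p k) * (1 - x) ^ (q k)) ≤ r ^ (p k) := by
      have h1 : (∫ x in Set.Ioc (0 : ℝ) r, x ^ (p k) * (1 - x) ^ (q k)) ≤
          ∫ x in Set.Ioc (0 : ℝ) r, r ^ (p k) := by
        refine setIntegral_mono_on (hint2 _ _) (by simp) measurableSet_Ioc fun x hx => ?_
        have h2 : x ^ (p k) ≤ r ^ (p k) := Real.rpow_le_rpow hx.1.le hx.2 hpk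
        have h3 : (1 - x) ^ (q k) ≤ 1 :=
          Real.rpow_le_one (by linarith [hx.2]) (by linarith [hx.1]) hq0
        have h4 : 0 ≤ x ^ (p k) := Real.rpow_nonneg hx.1.le _
        exact (mul_le_of_le_one_right h4 h3).trans h2
      refine h1.trans ?_
      have h5 : 0 ≤ r ^ (p k) := Real.rpow_nonneg hr0.le _
      simp only [setIntegral_const, smul_eq_mul, Real.volume_real_Ioc_of_le hr0.le]
      nlinarith
    have hhigh : s ^ (p k) * K ≤ ∫ x in Set.Ioo r 1, x ^ (p k) * (1 - x) ^ (q k) := by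
      have h1 : (∫ x in Set.Ioo s t, x ^ (p k) * (1 - x) ^ (q k)) ≤
          ∫ x in Set.Ioo r 1, x ^ (p k) * (1 - x) ^ (q k) := by
        refine setIntegral_mono_set (hint _ _) ?_
          (LE.le.eventuallyLE (Set.Ioo_subset_Ioo hrs.le ht1.le))
        refine (ae_restrict_iff' measurableSet_Ioo).2 (Eventually.of_forall fun x hx => ?_)
        exact mul_nonneg (Real.rpow_nonneg (by linarith [hx.1]) _)
          (Real.rpow_nonneg (by linarith [hx.2]) _)
      have h2 : (∫ x in Set.Ioo s t, s ^ (p k) * (1 - t) ^ C) ≤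
          ∫ x in Set.Ioo s t, x ^ (p k) * (1 - x) ^ (q k) := by
        refine setIntegral_mono_on (integrableOn_const (by simp)) (hint _ _) measurableSet_Ioo fun x hx => ?_
        have h3 : s ^ (p k) ≤ x ^ (p k) := Real.rpow_le_rpow hs0.le hx.1.le hpk
        have h4 : (1 - t) ^ C ≤ (1 - t) ^ (q k) :=
          Real.rpow_le_rpow_of_exponent_ge (by linarith) (by linarith) hqC
        have h5 : (1 - t) ^ (q k) ≤ (1 - x) ^ (q k) :=
          Real.rpow_le_rpow (by linarith) (by linarith [hx.2]) hq0
        exact mul_le_mul h3 (h4.trans h5) (Real.rpow_nonneg (by linarith) _)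
          (Real.rpow_nonneg (by linarith [hx.1]) _)
      refine le_trans (le_of_eq ?_) (h2.trans h1)
      simp only [setIntegral_const, smul_eq_mul, Real.volume_real_Ioo_of_le hst.le]
      rw [hK]; ring
    have hsp : 0 < s ^ (p k) := Real.rpow_pos_of_pos hs0 _
    have hhp : 0 < s ^ (p k) * K := mul_pos hsp hK0
    rw [hsplit, Real.div_rpow hr0.le hs0.le, div_div]
    generalize (∫ x in Set.Ioc (0 : ℝ) r, x ^ (p k) * (1 - x) ^ (q k)) = L at *
    generalize (∫ x in Set.Ioo r 1, x ^ (p k) * (1 - x) ^ (q k)) = H at *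
    have hLH : 0 < L + H := by linarith
    refine ⟨?_, (div_le_one hLH).2 (by linarith)⟩
    have e : H / (L + H) = 1 - L / (L + H) := by field_simp; ring
    rw [e]
    have : L / (L + H) ≤ r ^ (p k) / (s ^ (p k) * K) :=
      div_le_div₀ (hlow0.trans hlow) hlow hhp (by linarith)
    linarith
  exact tendsto_of_tendsto_of_tendsto_of_le_of_le' hlim tendsto_const_nhds
    (key.mono fun _ h => h.1) (key.mono fun _ h => h.2)

/-- Posterior convergence to 1 in the recursive Bayesian convergence assessment: if the
binary indicators `y j ∈ {0,1}` are eventually all `1`, then for every `δ ∈ (0,1)` the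
posterior Beta mass of `(1−δ, 1)` (with stage-`k` parameters
`a_k = ∑_{j≤k} 1/j² + ∑_{j≤k} y j` and `b_k = k + ∑_{j≤k} 1/j² − ∑_{j≤k} y j`)
tends to `1` as `k → ∞`. -/
theorem recursive_beta_posterior_tendsto_one
    (y : ℕ → ℝ) (hy : ∀ j, 1 ≤ j → y j = 0 ∨ y j = 1)
    (J : ℕ) (hJ : ∀ j, J ≤ j → y j = 1)
    (δ : ℝ) (hδ0 : 0 < δ) (hδ1 : δ < 1) :
    Tendsto (fun k : ℕ =>
      (∫ x in Set.Ioo (1 - δ) 1,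
          x ^ ((∑ j ∈ Finset.Icc 1 k, (1 / (j : ℝ) ^ 2) + ∑ j ∈ Finset.Icc 1 k, y j) - 1) *
          (1 - x) ^
            (((k : ℝ) + ∑ j ∈ Finset.Icc 1 k, (1 / (j : ℝ) ^ 2)
              - ∑ j ∈ Finset.Icc 1 k, y j) - 1)) /
      (∫ x in Set.Ioo 0 1,
          x ^ ((∑ j ∈ Finset.Icc 1 k, (1 / (j : ℝ) ^ 2) + ∑ j ∈ Finset.Icc 1 k, y j) - 1) *
          (1 - x) ^
            (((k : ℝ) + ∑ j ∈ Finset.Icc 1 k, (1 / (j : ℝ) ^ 2)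
              - ∑ j ∈ Finset.Icc 1 k, y j) - 1)))
      atTop (nhds 1) := by
  have hS1 : ∀ k : ℕ, 1 ≤ k → (1 : ℝ) ≤ ∑ j ∈ Finset.Icc 1 k, (1 / (j : ℝ) ^ 2) := by
    intro k hk
    have := Finset.single_le_sum (f := fun j : ℕ => 1 / (j : ℝ) ^ 2) (s := Finset.Icc 1 k)
      (fun i _ => by positivity) (Finset.mem_Icc.2 ⟨le_refl 1, hk⟩)
    simpa using this
  have hS2 : ∀ k : ℕ, ∑ j ∈ Finset.Icc 1 k, (1 / (j : ℝ) ^ 2) ≤ ∑' j : ℕ, 1 / (j : ℝ) ^ 2 :=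
    fun k => (Real.summable_one_div_nat_pow.2 (by norm_num)).sum_le_tsum _
      (fun i _ => by positivity)
  have hD : ∀ k : ℕ, (k : ℝ) - ∑ j ∈ Finset.Icc 1 k, y j = ∑ j ∈ Finset.Icc 1 k, (1 - y j) := by
    intro k
    simp [Finset.sum_sub_distrib]
  have hD0 : ∀ k : ℕ, 0 ≤ (k : ℝ) - ∑ j ∈ Finset.Icc 1 k, y j := by
    intro k
    rw [hD]
    refine Finset.sum_nonneg fun j hj => ?_
    rcases hy j (Finset.mem_Icc.1 hj).1 with h | h <;> simp [h]
  have hDJ : ∀ k : ℕ, (k : ℝ) - ∑ j ∈ Finset.Icc 1 k, y j ≤ J := by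
    intro k
    rw [hD]
    calc ∑ j ∈ Finset.Icc 1 k, (1 - y j)
        ≤ ∑ j ∈ Finset.Icc 1 k, (if j < J then (1 : ℝ) else 0) := by
          refine Finset.sum_le_sum fun j hj => ?_
          split_ifs with h
          · rcases hy j (Finset.mem_Icc.1 hj).1 with h | h <;> simp [h]
          · simp [hJ j (not_lt.1 h)]
      _ = (((Finset.Icc 1 k).filter (fun j => j < J)).card : ℝ) := by simp
      _ ≤ J := by
          have : ((Finset.Icc 1 k).filter (fun j => j < J)).card ≤ (Finset.range J).card :=
            Finset.card_le_card fun j hj => by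
              simp only [Finset.mem_filter] at hj
              exact Finset.mem_range.2 hj.2
          rw [Finset.card_range] at this
          exact_mod_cast this
  refine beta_aux _ _ (J + ∑' j : ℕ, 1 / (j : ℝ) ^ 2) ?_ ?_ δ hδ0 hδ1
  · refine tendsto_atTop_mono' atTop ?_
      (tendsto_atTop_add_const_right atTop (-(J : ℝ)) tendsto_natCast_atTop_atTop)
    filter_upwards [eventually_ge_atTop 1] with k hk
    linarith [hS1 k hk, hDJ k]
  · filter_upwards [eventually_ge_atTop 1] with k hk
    exact ⟨by linarith [hS1 k hk, hD0 k], by linarith [hS2 k, hDJ k]⟩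
end

section
/- Let y : ℕ → ℝ be a sequence with y(j) ∈ {0, 1} for every j ≥ 1, and for k ≥ 1 define a_k = ∑_{j=1}^k 1/j² + ∑_{j=1}^k y(j) and b_k = k + ∑_{j=1}^k 1/j² − ∑_{j=1}^k y(j). Suppose (1/k)·∑_{j=1}^k y(j) tends to 0 as k → ∞. Then for every δ ∈ (0,1), the ratio (∫_{(0,δ)} x^{a_k−1}·(1−x)^{b_k−1} dx) / (∫_{(0,1)} x^{a_k−1}·(1−x)^{b_k−1} dx) tends to 1 as k → ∞. -/
open MeasureTheory Filter

lemma beta_int_eq {a b : ℝ} (ha : 0 < a) (hb : 0 < b) :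
    ∫ x in Set.Ioo (0 : ℝ) 1, x ^ (a - 1) * (1 - x) ^ (b - 1) = ProbabilityTheory.beta a b := by
  rw [ProbabilityTheory.beta_eq_betaIntegralReal a b ha hb, Complex.betaIntegral,
    intervalIntegral.integral_of_le (by norm_num), ← integral_Ioc_eq_integral_Ioo,
    ← RCLike.re_to_complex, ← integral_re]
  · refine setIntegral_congr_fun measurableSet_Ioc fun x hx => ?_
    have h1 : (0 : ℝ) ≤ x := hx.1.le
    have h2 : (0 : ℝ) ≤ 1 - x := by linarith [hx.2]
    have e : (x : ℂ) ^ ((a : ℂ) - 1) * (1 - (x : ℂ)) ^ ((b : ℂ) - 1)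
        = ((x ^ (a - 1) * (1 - x) ^ (b - 1) : ℝ) : ℂ) := by
      rw [Complex.ofReal_mul, Complex.ofReal_cpow h1, Complex.ofReal_cpow h2]
      push_cast
      rfl
    simp only [e]
    simp
  · have := Complex.betaIntegral_convergent (u := a) (v := b) (by simpa) (by simpa)
    rwa [intervalIntegrable_iff_integrableOn_Ioc_of_le (by norm_num)] at this

lemma beta_succ {a b : ℝ} (ha : 0 < a) (hb : 0 < b) :
    ProbabilityTheory.beta (a + 1) b = a / (a + b) * ProbabilityTheory.beta a b := by
  unfold ProbabilityTheory.beta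
  rw [show a + 1 + b = (a + b) + 1 by ring, Real.Gamma_add_one ha.ne',
    Real.Gamma_add_one (by positivity)]
  have := (Real.Gamma_pos_of_pos (add_pos ha hb)).ne'
  field_simp

lemma beta_int_integrable {a b : ℝ} (ha : 0 < a) (hb : 0 < b) :
    IntegrableOn (fun x : ℝ => x ^ (a - 1) * (1 - x) ^ (b - 1)) (Set.Ioo 0 1) := by
  by_contra h
  have h1 := beta_int_eq ha hb
  rw [integral_undef h] at h1
  exact (ProbabilityTheory.beta_pos ha hb).ne h1

lemma beta_ratio_bounds {a b δ : ℝ} (ha : 0 < a) (hb : 0 < b) (h0 : 0 < δ) (h1 : δ < 1) :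
    1 - (a / (a + b)) / δ ≤ (∫ x in Set.Ioo (0 : ℝ) δ, x ^ (a - 1) * (1 - x) ^ (b - 1)) /
      (∫ x in Set.Ioo (0 : ℝ) 1, x ^ (a - 1) * (1 - x) ^ (b - 1)) ∧
    (∫ x in Set.Ioo (0 : ℝ) δ, x ^ (a - 1) * (1 - x) ^ (b - 1)) /
      (∫ x in Set.Ioo (0 : ℝ) 1, x ^ (a - 1) * (1 - x) ^ (b - 1)) ≤ 1 := by
  have hB := ProbabilityTheory.beta_pos ha hb
  have hI := beta_int_integrable ha hb
  have ha1 : 0 < a + 1 := by linarith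
  have hI2 := beta_int_integrable ha1 hb
  have hsplit : Set.Ioo (0 : ℝ) 1 = Set.Ioo 0 δ ∪ Set.Ico δ 1 :=
    (Set.Ioo_union_Ico_eq_Ioo h0 h1.le).symm
  have hsub1 : Set.Ioo (0 : ℝ) δ ⊆ Set.Ioo 0 1 := Set.Ioo_subset_Ioo_right h1.le
  have hsub2 : Set.Ico δ 1 ⊆ Set.Ioo (0 : ℝ) 1 := fun x hx => ⟨h0.trans_le hx.1, hx.2⟩
  have hadd : ∫ x in Set.Ioo (0 : ℝ) 1, x ^ (a - 1) * (1 - x) ^ (b - 1) =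
      (∫ x in Set.Ioo (0 : ℝ) δ, x ^ (a - 1) * (1 - x) ^ (b - 1)) +
      ∫ x in Set.Ico δ 1, x ^ (a - 1) * (1 - x) ^ (b - 1) := by
    rw [hsplit]
    refine setIntegral_union ?_ measurableSet_Ico (hI.mono_set hsub1) (hI.mono_set hsub2)
    exact Set.disjoint_left.2 fun x hx hx' => absurd hx.2 (not_lt.2 hx'.1)
  have hnn : ∀ c : ℝ, ∀ x ∈ Set.Ioo (0 : ℝ) 1, 0 ≤ x ^ c * (1 - x) ^ (b - 1) := fun c x hx =>
    mul_nonneg (Real.rpow_nonneg hx.1.le _) (Real.rpow_nonneg (by linarith [hx.2]) _)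
  have htail0 : 0 ≤ ∫ x in Set.Ico δ 1, x ^ (a - 1) * (1 - x) ^ (b - 1) :=
    setIntegral_nonneg measurableSet_Ico fun x hx => hnn _ x (hsub2 hx)
  have htail : δ * ∫ x in Set.Ico δ 1, x ^ (a - 1) * (1 - x) ^ (b - 1) ≤
      a / (a + b) * ProbabilityTheory.beta a b := by
    rw [← beta_succ ha hb, ← beta_int_eq ha1 hb, ← integral_const_mul]
    refine le_trans (setIntegral_mono_on ((hI.mono_set hsub2).const_mul δ)
      (hI2.mono_set hsub2) measurableSet_Ico fun x hx => ?_)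
      (setIntegral_mono_set hI2 ?_ hsub2.eventuallyLE)
    · have hx0 : 0 < x := (hsub2 hx).1
      have : x ^ (a + 1 - 1) = x * x ^ (a - 1) := by
        rw [show a + 1 - 1 = 1 + (a - 1) by ring, Real.rpow_add hx0, Real.rpow_one]
      rw [this, mul_assoc]
      exact mul_le_mul_of_nonneg_right hx.1 (hnn _ x (hsub2 hx))
    · exact (ae_restrict_iff' measurableSet_Ioo).2 (Eventually.of_forall fun x hx => hnn _ x hx)
  rw [beta_int_eq ha hb] at hadd ⊢
  constructor
  · rw [le_div_iff₀ hB]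
    have : (∫ x in Set.Ico δ 1, x ^ (a - 1) * (1 - x) ^ (b - 1)) ≤
        a / (a + b) * ProbabilityTheory.beta a b / δ := by
      rw [le_div_iff₀ h0]; linarith
    have e : (1 - a / (a + b) / δ) * ProbabilityTheory.beta a b =
      ProbabilityTheory.beta a b - a / (a + b) * ProbabilityTheory.beta a b / δ := by ring
    rw [e]; linarith
  · rw [div_le_one hB]; linarith

/-- Posterior convergence to 0 in the recursive Bayesian convergence assessment: if the
averages `(1/k)·∑_{j≤k} y j` of the binary indicators `y j ∈ {0,1}` tend to `0`, then for
every `δ ∈ (0,1)` the posterior Beta mass of `(0, δ)` (with stage-`k` parameters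
`a_k = ∑_{j≤k} 1/j² + ∑_{j≤k} y j` and `b_k = k + ∑_{j≤k} 1/j² − ∑_{j≤k} y j`)
tends to `1` as `k → ∞`. -/
theorem recursive_beta_posterior_tendsto_zero_nbhd
    (y : ℕ → ℝ) (hy : ∀ j, 1 ≤ j → y j = 0 ∨ y j = 1)
    (hmean : Tendsto (fun k : ℕ => (∑ j ∈ Finset.Icc 1 k, y j) / (k : ℝ))
      atTop (nhds 0))
    (δ : ℝ) (hδ0 : 0 < δ) (hδ1 : δ < 1) :
    Tendsto (fun k : ℕ =>
      (∫ x in Set.Ioo (0 : ℝ) δ,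
          x ^ ((∑ j ∈ Finset.Icc 1 k, (1 / (j : ℝ) ^ 2) + ∑ j ∈ Finset.Icc 1 k, y j) - 1) *
          (1 - x) ^
            (((k : ℝ) + ∑ j ∈ Finset.Icc 1 k, (1 / (j : ℝ) ^ 2)
              - ∑ j ∈ Finset.Icc 1 k, y j) - 1)) /
      (∫ x in Set.Ioo (0 : ℝ) 1,
          x ^ ((∑ j ∈ Finset.Icc 1 k, (1 / (j : ℝ) ^ 2) + ∑ j ∈ Finset.Icc 1 k, y j) - 1) *
          (1 - x) ^
            (((k : ℝ) + ∑ j ∈ Finset.Icc 1 k, (1 / (j : ℝ) ^ 2)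
              - ∑ j ∈ Finset.Icc 1 k, y j) - 1)))
      atTop (nhds 1) := by
  obtain ⟨C, hC⟩ : ∃ C : ℝ, ∀ k : ℕ, ∑ j ∈ Finset.Icc 1 k, (1 / (j : ℝ) ^ 2) ≤ C :=
    ⟨_, fun k => (Real.summable_one_div_nat_pow.2 one_lt_two).sum_le_tsum _
      fun i _ => by positivity⟩
  have hY0 : ∀ k : ℕ, 0 ≤ ∑ j ∈ Finset.Icc 1 k, y j := fun k => Finset.sum_nonneg fun j hj => by
    rcases hy j (Finset.mem_Icc.1 hj).1 with h | h <;> rw [h] <;> norm_num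
  have hYk : ∀ k : ℕ, ∑ j ∈ Finset.Icc 1 k, y j ≤ k := fun k => by
    have : ∑ j ∈ Finset.Icc 1 k, y j ≤ ∑ j ∈ Finset.Icc 1 k, (1 : ℝ) :=
      Finset.sum_le_sum fun j hj => by
        rcases hy j (Finset.mem_Icc.1 hj).1 with h | h <;> rw [h] <;> norm_num
    simpa using this
  have hS : ∀ k : ℕ, 1 ≤ k → 0 < ∑ j ∈ Finset.Icc 1 k, (1 / (j : ℝ) ^ 2) := fun k hk =>
    Finset.sum_pos (fun j hj => by
      have : (0 : ℝ) < j := by exact_mod_cast (Finset.mem_Icc.1 hj).1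
      positivity) ⟨1, by simpa using hk⟩
  have hlow : Tendsto (fun k : ℕ => 1 - (C / (k : ℝ) + (∑ j ∈ Finset.Icc 1 k, y j) / (k : ℝ)) / δ)
      atTop (nhds 1) := by
    have h := (((tendsto_const_div_atTop_nhds_zero_nat C).add hmean).div_const δ).const_sub 1
    simpa using h
  refine tendsto_of_tendsto_of_tendsto_of_le_of_le' hlow tendsto_const_nhds ?_ ?_
  all_goals
    filter_upwards [eventually_ge_atTop 1] with k hk
    have h1 := hS k hk
    have h2 := hY0 k
    have h3 := hYk k
    have h4 := hC k
    have hk0 : (0 : ℝ) < k := by exact_mod_cast hk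
    generalize ∑ j ∈ Finset.Icc 1 k, (1 / (j : ℝ) ^ 2) = S at *
    generalize ∑ j ∈ Finset.Icc 1 k, y j = Y at *
    have hb := beta_ratio_bounds (a := S + Y) (b := k + S - Y) (by linarith) (by linarith) hδ0 hδ1
  · refine le_trans ?_ hb.1
    have : (S + Y) / (S + Y + (k + S - Y)) ≤ C / k + Y / k := by
      rw [← add_div]
      exact div_le_div₀ (by linarith) (by linarith) hk0 (by linarith)
    gcongr
  · exact hb.2
end

section
/- Let X : ℕ → ℝ. The series ∑_i X_i converges (the partial sums ∑_{i=1}^n X_i tend to a finite limit) if and only if there exists a sequence c : ℕ → ℝ which is antitone (nonincreasing), satisfies c_j ≥ 0 for all j and c_j → 0 as j → ∞, such that for every strictly increasing function N : ℕ → ℕ with N(0) = 0, the block sums eventually satisfy the bound: there exists J such that for all j ≥ J, |∑_{i=N(j−1)+1}^{N(j)} X_i| ≤ c_j. -/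
open Filter

theorem block_sum_eq (X : ℕ → ℝ) {a b : ℕ} (h : a ≤ b) :
    |∑ i ∈ Finset.Ioc a b, X i| =
      dist (∑ i ∈ Finset.Icc 1 b, X i) (∑ i ∈ Finset.Icc 1 a, X i) := by
  have e : ∀ n, ∑ i ∈ Finset.Icc 1 n, X i = ∑ i ∈ Finset.Ioc 0 n, X i := fun n => rfl
  rw [Real.dist_eq, e, e, ← Finset.sum_Ioc_consecutive X (Nat.zero_le a) h]
  congr 1
  ring

/-- Convergence characterisation: the series `∑ Xᵢ` converges if and only if there is a
nonincreasing nonnegative sequence `c` tending to `0` such that for every partition of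
the index set into consecutive blocks `(N(j−1), N(j)]` (with `N` strictly increasing,
`N 0 = 0`), the block sums eventually satisfy `|S_j| ≤ c j`. -/
theorem convergence_iff_eventual_block_bound
    (X : ℕ → ℝ) :
    (∃ l : ℝ,
      Tendsto (fun n : ℕ => ∑ i ∈ Finset.Icc 1 n, X i) atTop (nhds l)) ↔
    ∃ c : ℕ → ℝ, Antitone c ∧ (∀ j, 0 ≤ c j) ∧ Tendsto c atTop (nhds 0) ∧
      ∀ N : ℕ → ℕ, StrictMono N → N 0 = 0 →
        ∃ J : ℕ, ∀ j, J ≤ j → |∑ i ∈ Finset.Ioc (N (j - 1)) (N j), X i| ≤ c j := by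
  set S : ℕ → ℝ := fun n : ℕ => ∑ i ∈ Finset.Icc 1 n, X i with hS
  constructor
  · rintro ⟨l, hl⟩
    have hC : CauchySeq S := hl.cauchySeq
    have hbd : ∀ j : ℕ, Bornology.IsBounded (S '' Set.Ici (j - 1)) := fun j =>
      (Metric.isBounded_range_of_tendsto S hl).subset (Set.image_subset_range _ _)
    refine ⟨fun j => Metric.diam (S '' Set.Ici (j - 1)), ?_, fun _ => Metric.diam_nonneg, ?_, ?_⟩
    · intro a b hab
      exact Metric.diam_mono (Set.image_mono (Set.Ici_subset_Ici.2 (by omega))) (hbd a)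
    · obtain ⟨b, hb0, hb, hbt⟩ := cauchySeq_iff_le_tendsto_0.1 hC
      refine squeeze_zero (fun _ => Metric.diam_nonneg) (fun j => ?_)
        (hbt.comp (tendsto_sub_atTop_nat 1))
      refine Metric.diam_le_of_forall_dist_le (hb0 _) ?_
      rintro _ ⟨n, hn, rfl⟩ _ ⟨m, hm, rfl⟩
      exact hb n m _ hn hm
    · intro N hN _
      refine ⟨0, fun j _ => ?_⟩
      rw [block_sum_eq X (hN.monotone (Nat.sub_le j 1))]
      have h1 : j - 1 ≤ N (j - 1) := hN.id_le _
      have h2 : j ≤ N j := hN.id_le _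
      exact Metric.dist_le_diam_of_mem (hbd j)
        (Set.mem_image_of_mem S (Set.mem_Ici.2 (by omega)))
        (Set.mem_image_of_mem S (Set.mem_Ici.2 h1))
  · rintro ⟨c, _, _, hc, h⟩
    suffices hC : CauchySeq S from cauchySeq_tendsto_of_complete hC
    by_contra hC
    rw [Metric.cauchySeq_iff'] at hC
    push Not at hC
    obtain ⟨ε, hε, hC⟩ := hC
    choose φ hφ hd using hC
    have hφ' : ∀ n, n < φ n := by
      intro n
      refine lt_of_le_of_ne (hφ n) fun he => ?_
      have := hd n
      rw [← he, dist_self] at this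
      linarith
    let g : ℕ → ℕ := fun k => Nat.rec 0 (fun _ m => φ (m + 1)) k
    have hg : ∀ k, g (k + 1) = φ (g k + 1) := fun k => rfl
    let N : ℕ → ℕ := fun j => g (j / 2) + j % 2
    have hE : ∀ k, N (2 * k) = g k := fun k => by simp [N]
    have hO : ∀ k, N (2 * k + 1) = g k + 1 := fun k => by
      have h1 : (2 * k + 1) / 2 = k := by omega
      have h2 : (2 * k + 1) % 2 = 1 := by omega
      simp only [N, h1, h2]
    have hN : StrictMono N := by
      refine strictMono_nat_of_lt_succ fun j => ?_
      obtain ⟨k, rfl | rfl⟩ := Nat.even_or_odd' j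
      · rw [hE, hO]; omega
      · rw [show 2 * k + 1 + 1 = 2 * (k + 1) by ring, hE, hO, hg]
        exact hφ' _
    obtain ⟨J, hJ⟩ := h N hN rfl
    obtain ⟨K, hK⟩ := eventually_atTop.1 (hc.eventually (gt_mem_nhds hε))
    have h1 := hJ (2 * (J + K + 1)) (by omega)
    have h2 := hK (2 * (J + K + 1)) (by omega)
    rw [block_sum_eq X (hN.monotone (Nat.sub_le _ 1)),
      show 2 * (J + K + 1) - 1 = 2 * (J + K) + 1 by omega, hE, hO, hg] at h1
    have h3 := hd (g (J + K) + 1)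
    simp only [hS] at h3
    linarith
end
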